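/- Let G be the 8 × 8 real symmetric matrix with all diagonal entries equal to 1 and off-diagonal entries (symmetrically extended) G₁₂ = −1, G₁₃ = −√6/2, G₂₄ = −√6/2, G₃₅ = −1/2, G₄₈ = −1/2, G₅₆ = −1/2, G₅₇ = −1/2, G₆₈ = −1/2, G₇₈ = −1/2, and all other off-diagonal entries 0. Then G has exactly 5 positive eigenvalues (with multiplicity), exactly 1 negative eigenvalue, and exactly 2 zero eigenvalues; equivalently G has rank 6 and signature (5,1). -/

import Mathlib

open Real

noncomputable def G8 : Matrix (Fin 8) (Fin 8) ℝ :=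
  !![1, -1, -(Real.sqrt 6 / 2), 0, 0, 0, 0, 0;
     -1, 1, 0, -(Real.sqrt 6 / 2), 0, 0, 0, 0;
     -(Real.sqrt 6 / 2), 0, 1, 0, -(1/2), 0, 0, 0;
     0, -(Real.sqrt 6 / 2), 0, 1, 0, 0, 0, -(1/2);
     0, 0, -(1/2), 0, 1, -(1/2), -(1/2), 0;
     0, 0, 0, 0, -(1/2), 1, 0, -(1/2);
     0, 0, 0, 0, -(1/2), 0, 1, -(1/2);
     0, 0, 0, -(1/2), 0, -(1/2), -(1/2), 1]

/-- A congruence between `A` and `diagonal w` identifies the quadratic form of `A` with a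
weighted sum of squares. -/
theorem Matrix.equivalent_weightedSumSquares_of_congruence {n : Type*} [Fintype n] [DecidableEq n]
    {A P R : Matrix n n ℝ} {w : n → ℝ} (hPR : P * R = 1) (hA : A = P.transpose * diagonal w * P) :
    QuadraticMap.Equivalent A.toQuadraticForm' (QuadraticMap.weightedSumSquares ℝ w) := by
  refine ⟨⟨Matrix.toLin'OfInv hPR (mul_eq_one_comm.mp hPR) |>.symm, fun x => ?_⟩⟩
  change QuadraticMap.weightedSumSquares ℝ w (P.mulVec x) = A.toQuadraticForm' x
  rw [hA, Matrix.toQuadraticForm', LinearMap.BilinMap.toQuadraticMap_apply,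
    Matrix.toLinearMap₂'_apply', ← mulVec_mulVec, ← mulVec_mulVec, dotProduct_mulVec,
    vecMul_transpose, QuadraticMap.weightedSumSquares_apply]
  refine Finset.sum_congr rfl fun i _ => ?_
  rw [mulVec_diagonal, smul_eq_mul]
  ring

/-- The quadratic form of a real symmetric matrix is a sum of squares weighted by eigenvalues. -/
theorem Matrix.IsHermitian.equivalent_weightedSumSquares_eigenvalues {n : Type*} [Fintype n]
    [DecidableEq n] {A : Matrix n n ℝ} (hA : A.IsHermitian) :
    QuadraticMap.Equivalent A.toQuadraticForm'
      (QuadraticMap.weightedSumSquares ℝ hA.eigenvalues) := by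
  refine Matrix.equivalent_weightedSumSquares_of_congruence
    (P := star (hA.eigenvectorUnitary : Matrix n n ℝ)) (R := hA.eigenvectorUnitary)
    (Unitary.coe_star_mul_self _) ?_
  have h := hA.spectral_theorem
  rw [Unitary.conjStarAlgAut_apply] at h
  rwa [star_eq_conjTranspose, conjTranspose_eq_transpose_of_trivial, transpose_transpose]

/-- The numbers of positive and negative eigenvalues can be read off any diagonal matrix congruent
to a real symmetric matrix. -/
theorem Matrix.IsHermitian.card_eigenvalues_of_congruence {n : Type*} [Fintype n] [DecidableEq n]
    {A P R : Matrix n n ℝ} (hA : A.IsHermitian) {w : n → ℝ} (hPR : P * R = 1)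
    (h : A = P.transpose * diagonal w * P) :
    (Finset.univ.filter fun j => 0 < hA.eigenvalues j).card =
        (Finset.univ.filter fun j => 0 < w j).card ∧
      (Finset.univ.filter fun j => hA.eigenvalues j < 0).card =
        (Finset.univ.filter fun j => w j < 0).card := by
  have hw := Matrix.equivalent_weightedSumSquares_of_congruence hPR h
  have he := hA.equivalent_weightedSumSquares_eigenvalues
  have hp := (QuadraticForm.sigPos_of_equiv_weightedSumSquares he).symm.trans
    (QuadraticForm.sigPos_of_equiv_weightedSumSquares hw)
  have hn := (QuadraticForm.sigNeg_of_equiv_weightedSumSquares he).symm.trans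
    (QuadraticForm.sigNeg_of_equiv_weightedSumSquares hw)
  simpa [Set.ncard_eq_toFinset_card'] using And.intro hp hn

/-- Coordinates diagonalising the quadratic form of `G8`. -/
noncomputable def diagonalCoords : Matrix (Fin 8) (Fin 8) ℝ :=
  !![1, -1, -(√6 / 4), √6 / 4, 0, 0, 0, 0;
     0, 0, -(1/2), 1/2, 1, 0, 0, -1;
     -(√6 / 2), -(√6 / 2), 1, 1, -(1/2), 0, 0, -(1/2);
     0, 0, 0, 0, -(1/2), 1, 0, -(1/2);
     0, 0, 0, 0, -(1/2), 0, 1, -(1/2);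
     √6, √6, 0, 0, 1, 0, 0, 1;
     0, 0, 1, -1, 0, 0, 0, 0;
     1, 1, 0, 0, 0, 0, 0, 0]

/-- The inverse of `diagonalCoords`. -/
noncomputable def diagonalCoordsInv : Matrix (Fin 8) (Fin 8) ℝ :=
  !![1/2, 0, 0, 0, 0, 0, √6 / 8, 1/2;
     -(1/2), 0, 0, 0, 0, 0, -(√6 / 8), 1/2;
     0, 0, 1/2, 0, 0, 1/4, 1/2, 0;
     0, 0, 1/2, 0, 0, 1/4, -(1/2), 0;
     0, 1/2, 0, 0, 0, 1/2, 1/4, -(√6 / 2);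
     0, 0, 0, 1, 0, 1/2, 0, -(√6 / 2);
     0, 0, 0, 0, 1, 1/2, 0, -(√6 / 2);
     0, -(1/2), 0, 0, 0, 1/2, -(1/4), -(√6 / 2)]

/-- The coefficients of the squares in the diagonalised form of `G8`. -/
noncomputable def diagonalWeights : Fin 8 → ℝ :=
  ![1, 1/2, 1/2, 1, 1, -(1/8), 0, 0]

theorem diagonalCoords_mul_inv : diagonalCoords * diagonalCoordsInv = 1 := by
  ext i j
  fin_cases i <;> fin_cases j <;>
    simp [diagonalCoords, diagonalCoordsInv, Matrix.mul_apply, Fin.sum_univ_eight] <;> ring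

theorem G8_eq_congruence :
    G8 = diagonalCoords.transpose * Matrix.diagonal diagonalWeights * diagonalCoords := by
  have h6 : √6 ^ 2 = 6 := Real.sq_sqrt (by norm_num)
  ext i j
  fin_cases i <;> fin_cases j <;>
    simp [G8, diagonalCoords, diagonalWeights, Matrix.mul_apply, Matrix.diagonal_apply,
      Fin.sum_univ_eight] <;> ring_nf <;> simp [h6] <;> norm_num

theorem stmt_8 (hG : G8.IsHermitian) :
    (Finset.univ.filter fun j => 0 < hG.eigenvalues j).card = 5 ∧
    (Finset.univ.filter fun j => hG.eigenvalues j < 0).card = 1 ∧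
    (Finset.univ.filter fun j => hG.eigenvalues j = 0).card = 2 ∧
    G8.rank = 6 := by
  obtain ⟨hp, hn⟩ := hG.card_eigenvalues_of_congruence diagonalCoords_mul_inv G8_eq_congruence
  have hp5 : (Finset.univ.filter fun j => 0 < hG.eigenvalues j).card = 5 := by
    rw [hp, Finset.card_filter, Fin.sum_univ_eight]
    simp [diagonalWeights]
  have hn1 : (Finset.univ.filter fun j => hG.eigenvalues j < 0).card = 1 := by
    rw [hn, Finset.card_filter, Fin.sum_univ_eight]
    simp [diagonalWeights]
  have hne : (Finset.univ.filter fun j => hG.eigenvalues j ≠ 0).card = 6 := by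
    simp_rw [ne_iff_lt_or_gt, Finset.filter_or]
    rw [Finset.card_union_of_disjoint, hn1, hp5]
    exact Finset.disjoint_filter.mpr fun _ _ h => h.not_gt
  have hz := Finset.card_filter_add_card_filter_not (s := Finset.univ)
    fun j => hG.eigenvalues j = 0
  rw [Finset.card_univ, Fintype.card_fin] at hz
  refine ⟨hp5, hn1, by lia, ?_⟩
  rw [hG.rank_eq_card_non_zero_eigs, Fintype.card_subtype, hne]
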